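/- arXiv:2311.17342 — 6 statements merged into one kernel-verified Lean document; each statement's English description precedes it below -/
import Mathlib

section
/- Let G be a finite connected simple graph with at least one edge. Then tw(L(G)) ≥ tw(G) − 1, where L(G) is the line graph of G. -/
open SimpleGraph

universe u

/-- A tree decomposition of a graph `G`: a finite tree `T` together with a bag of
vertices for each node, covering all vertices and all edges, such that for each vertex
the set of nodes whose bag contains it induces a connected subtree. -/
structure TreeDecomp {V : Type u} (G : SimpleGraph V) where
  β : Type
  fintypeβ : Fintype β
  T : SimpleGraph β
  isTree : T.IsTree
  bag : β → Finset V
  bag_cover : ∀ v : V, ∃ t, v ∈ bag t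
  bag_edge : ∀ u v : V, G.Adj u v → ∃ t, u ∈ bag t ∧ v ∈ bag t
  bag_conn : ∀ v : V, (T.induce {t | v ∈ bag t}).Connected

/-- The width of a tree decomposition: the maximum bag size minus one. -/
noncomputable def TreeDecomp.width {V : Type u} {G : SimpleGraph V} (D : TreeDecomp G) : ℕ :=
  sSup {n | ∃ t : D.β, (D.bag t).card = n} - 1

/-- The treewidth of `G`: the minimum width of a tree decomposition of `G`. -/
noncomputable def treewidth {V : Type u} (G : SimpleGraph V) : ℕ :=
  sInf {n | ∃ D : TreeDecomp G, D.width = n}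

namespace SimpleGraph

theorem Connected.exists_isPath_support_subset {β : Type*} {T : SimpleGraph β} {A : Set β}
    (hA : (T.induce A).Connected) {a b : β} (ha : a ∈ A) (hb : b ∈ A) :
    ∃ p : T.Walk a b, p.IsPath ∧ ∀ x ∈ p.support, x ∈ A := by
  obtain ⟨p, hp⟩ := hA.exists_isPath ⟨a, ha⟩ ⟨b, hb⟩
  refine ⟨p.map (Embedding.induce A).toHom, hp.map Subtype.val_injective, ?_⟩
  intro x hx
  obtain ⟨y, -, rfl⟩ := List.mem_map.1 (Walk.support_map (Embedding.induce A).toHom p ▸ hx)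
  exact y.2

/-- A shortest path from `r` to a nonempty set of vertices meets that set only at its end. -/
theorem Connected.exists_isPath_to_set {β : Type*} {T : SimpleGraph β} (hT : T.Connected)
    (r : β) {A : Set β} (hA : A.Nonempty) :
    ∃ a ∈ A, ∃ p : T.Walk r a, p.IsPath ∧ ∀ x ∈ p.support, x ∈ A → x = a := by
  classical
  obtain ⟨a, ha, hmin⟩ := (measure (T.dist r)).wf.has_min A hA
  obtain ⟨p, hp, hlen⟩ := hT.exists_path_of_dist r a
  refine ⟨a, ha, p, hp, fun x hx hxA => ?_⟩
  by_contra hne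
  have h₁ := Walk.length_takeUntil_lt_length hx hne
  have h₂ := dist_le (p.takeUntil x hx)
  exact hmin x hxA (show T.dist r x < T.dist r a by omega)

theorem Walk.IsPath.append_of_inter_subset {β : Type*} {T : SimpleGraph β} {a b c : β}
    {p : T.Walk a b} {q : T.Walk b c} (hp : p.IsPath) (hq : q.IsPath)
    (h : ∀ x ∈ p.support, x ∈ q.support → x = b) : (p.append q).IsPath := by
  have hq' := hq.support_nodup
  rw [← q.cons_tail_support, List.nodup_cons] at hq'
  rw [isPath_def, support_append]
  refine hp.support_nodup.append hq'.2 fun x hx hx' => ?_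
  have := h x hx (List.mem_of_mem_tail hx')
  exact hq'.1 (this ▸ hx')

/-- The Helly property of subtrees of a tree. -/
theorem IsTree.exists_mem_forall_of_pairwise_inter {β ι : Type*} [Finite ι] {T : SimpleGraph β}
    (hT : T.IsTree) (A : ι → Set β) (hA : ∀ i, (T.induce (A i)).Connected)
    (hinter : ∀ i j, (A i ∩ A j).Nonempty) : ∃ t, ∀ i, t ∈ A i := by
  obtain ⟨r⟩ := hT.connected.nonempty
  rcases isEmpty_or_nonempty ι with hι | hι
  · exact ⟨r, fun i => hι.elim i⟩
  choose a ha p hp hpA using fun i =>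
    hT.connected.exists_isPath_to_set r ((hinter i i).mono Set.inter_subset_left)
  obtain ⟨i, hi⟩ := Finite.exists_max fun i => (p i).length
  refine ⟨a i, fun j => ?_⟩
  obtain ⟨z, hzi, hzj⟩ := hinter i j
  obtain ⟨q, hq, hqA⟩ := (hA i).exists_isPath_support_subset (ha i) hzi
  obtain ⟨q', hq', hqA'⟩ := (hA j).exists_isPath_support_subset (ha j) hzj
  have heq : (p i).append q = (p j).append q' :=
    (hT.existsUnique_path r z).unique
      ((hp i).append_of_inter_subset hq fun x hx hx' => hpA i x hx (hqA x hx'))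
      ((hp j).append_of_inter_subset hq' fun x hx hx' => hpA j x hx (hqA' x hx'))
  have hget := congrArg (fun w => w.getVert (p i).length) heq
  simp only [Walk.getVert_append, lt_irrefl, if_false, Nat.sub_self, Walk.getVert_zero,
    if_neg (hi j).not_gt] at hget
  exact hget ▸ hqA' _ (q'.getVert_mem_support _)

/-- The graph obtained from `T` by attaching, for each `i`, a new leaf at the vertex `f i`. -/
def attachLeaves {β ι : Type*} (T : SimpleGraph β) (f : ι → β) : SimpleGraph (β ⊕ ι) where
  Adj
    | .inl s, .inl t => T.Adj s t
    | .inl s, .inr i => s = f i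
    | .inr i, .inl s => s = f i
    | .inr _, .inr _ => False
  symm := ⟨by
    rintro (s | i) (t | j) h
    exacts [Adj.symm h, h, h, h]⟩
  loopless := ⟨by
    rintro (s | i) h
    exacts [Adj.ne h rfl, h]⟩

theorem IsTree.attachLeaves {β ι : Type*} [Finite β] [Finite ι] {T : SimpleGraph β}
    (hT : T.IsTree) (f : ι → β) : (T.attachLeaves f).IsTree := by
  have hconn : (T.attachLeaves f).Connected := by
    obtain ⟨r⟩ := hT.connected.nonempty
    let φ : T →g T.attachLeaves f := ⟨Sum.inl, fun h => h⟩
    refine (connected_iff_exists_forall_reachable _).2 ⟨.inl r, ?_⟩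
    have hl : ∀ s, (T.attachLeaves f).Reachable (.inl r) (.inl s) := fun s =>
      (hT.connected.preconnected r s).map φ
    rintro (s | i)
    · exact hl s
    · exact (hl (f i)).trans (Adj.reachable (show f i = f i from rfl))
  refine isTree_iff_connected_and_card.2 ⟨hconn, le_antisymm ?_
    hconn.card_vert_le_card_edgeSet_add_one⟩
  have hcard := (isTree_iff_connected_and_card.1 hT).2
  have hsub : (T.attachLeaves f).edgeSet ⊆
      (Sym2.map Sum.inl '' T.edgeSet) ∪ Set.range fun i => s(Sum.inl (f i), Sum.inr i) := by
    intro e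
    induction e using Sym2.ind with
    | _ x y =>
      rw [mem_edgeSet]
      rcases x with s | i <;> rcases y with t | j <;> intro h
      · exact .inl ⟨s(s, t), h, rfl⟩
      · obtain rfl : s = f j := h
        exact .inr ⟨j, rfl⟩
      · obtain rfl : t = f i := h
        exact .inr ⟨i, Sym2.eq_swap⟩
      · exact h.elim
  have h₁ := (Set.ncard_le_ncard hsub (Set.toFinite _)).trans (Set.ncard_union_le _ _)
  have h₂ : (Sym2.map (Sum.inl : β → β ⊕ ι) '' T.edgeSet).ncard ≤ T.edgeSet.ncard :=
    Set.ncard_image_le (Set.toFinite _)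
  have h₃ : (Set.range fun i => s((Sum.inl (f i) : β ⊕ ι), Sum.inr i)).ncard ≤ Nat.card ι := by
    rw [← Set.image_univ, ← Set.ncard_univ]
    exact Set.ncard_image_le (Set.toFinite _)
  rw [Nat.card_sum, ← hcard, Nat.card_coe_set_eq, Nat.card_coe_set_eq]
  omega

end SimpleGraph

namespace TreeDecomp

variable {V : Type u} {G : SimpleGraph V}

theorem card_bag_le (D : TreeDecomp G) (t : D.β) : (D.bag t).card ≤ D.width + 1 := by
  have := D.fintypeβ
  have hfin : {n | ∃ t : D.β, (D.bag t).card = n}.Finite :=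
    Set.finite_range fun t => (D.bag t).card
  have := le_csSup hfin.bddAbove ⟨t, rfl⟩
  unfold width
  omega

theorem width_le (D : TreeDecomp G) {k : ℕ} (h : ∀ t, (D.bag t).card ≤ k + 1) : D.width ≤ k := by
  obtain ⟨t⟩ := D.isTree.connected.nonempty
  have : sSup {n | ∃ t : D.β, (D.bag t).card = n} ≤ k + 1 :=
    csSup_le ⟨_, t, rfl⟩ (by rintro _ ⟨s, rfl⟩; exact h s)
  unfold width
  omega

/-- The tree decomposition with a single bag. -/
def trivial [Fintype V] (G : SimpleGraph V) : TreeDecomp G where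
  β := Unit
  fintypeβ := inferInstance
  T := ⊥
  isTree := .of_subsingleton
  bag _ := Finset.univ
  bag_cover _ := ⟨(), Finset.mem_univ _⟩
  bag_edge _ _ _ := ⟨(), Finset.mem_univ _, Finset.mem_univ _⟩
  bag_conn v :=
    have : Nonempty {_t : Unit | v ∈ Finset.univ} := ⟨⟨(), Finset.mem_univ v⟩⟩
    IsTree.of_subsingleton.connected

theorem exists_bag_superset_of_isClique [Finite V] (D : TreeDecomp G) {s : Set V}
    (hs : G.IsClique s) : ∃ t, ∀ v ∈ s, v ∈ D.bag t := by
  obtain ⟨t, ht⟩ := D.isTree.exists_mem_forall_of_pairwise_inter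
    (fun v : s => {t | v.1 ∈ D.bag t}) (fun v => D.bag_conn v) (by
      intro u v
      by_cases huv : u = v
      · subst huv
        obtain ⟨t, ht⟩ := D.bag_cover u
        exact ⟨t, ht, ht⟩
      · exact D.bag_edge u v (hs u.2 v.2 (Subtype.coe_injective.ne huv)))
  exact ⟨t, fun v hv => ht ⟨v, hv⟩⟩

/-- A tree decomposition of the line graph yields one of the graph: replace each edge by one
of its endpoints and attach, for each vertex `v`, a leaf whose bag also contains `v` at a node
whose bag contains all the edges at `v`. -/
theorem exists_width_le_of_lineGraph [Fintype V] (D : TreeDecomp G.lineGraph) :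
    ∃ D' : TreeDecomp G, D'.width ≤ D.width + 1 := by
  classical
  have := D.fintypeβ
  have hclique : ∀ v : V, G.lineGraph.IsClique {e | v ∈ e.1} := fun v e he e' he' hne =>
    ⟨hne, v, he, he'⟩
  choose f hf using fun v => D.exists_bag_superset_of_isClique (hclique v)
  let c : G.edgeSet → V := fun e => e.1.out.1
  have hc : ∀ e, c e ∈ e.1 := fun e => e.1.out_fst_mem
  let φ := Fintype.equivFin V
  let g : Fin (Fintype.card V) → D.β := fun i => f (φ.symm i)
  let bag : D.β ⊕ Fin (Fintype.card V) → Finset V :=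
    Sum.elim (fun t => (D.bag t).image c) fun i => insert (φ.symm i) ((D.bag (g i)).image c)
  have hself : ∀ v, v ∈ bag (.inr (φ v)) := fun v => by simp [bag]
  have hleaf : ∀ {v i}, v ∈ bag (.inl (g i)) → v ∈ bag (.inr i) := fun h =>
    Finset.mem_insert_of_mem h
  have hedge : ∀ {e : G.edgeSet} {v}, v ∈ e.1 → c e ∈ bag (.inr (φ v)) := fun {e v} hv =>
    hleaf (Finset.mem_image_of_mem c (by simpa [g] using hf v e hv))
  let D' : TreeDecomp G :=
    { β := D.β ⊕ Fin (Fintype.card V)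
      fintypeβ := inferInstance
      T := D.T.attachLeaves g
      isTree := D.isTree.attachLeaves g
      bag := bag
      bag_cover := fun v => ⟨_, hself v⟩
      bag_edge := by
        intro u v huv
        have hcuv := hc ⟨s(u, v), huv⟩
        rcases Sym2.mem_iff.1 hcuv with h | h
        · exact ⟨_, h ▸ hedge (e := ⟨s(u, v), huv⟩) (Sym2.mem_mk_right u v), hself v⟩
        · exact ⟨_, hself u, h ▸ hedge (e := ⟨s(u, v), huv⟩) (Sym2.mem_mk_left u v)⟩
      bag_conn := by
        intro v
        have hadj : ∀ i (h : v ∈ bag (.inl (g i))),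
            ((D.T.attachLeaves g).induce {t | v ∈ bag t}).Reachable
              ⟨.inl (g i), h⟩ ⟨.inr i, hleaf h⟩ := fun i h =>
          Adj.reachable (show g i = g i from rfl)
        have hl : ∀ t (h : v ∈ bag (.inl t)),
            ((D.T.attachLeaves g).induce {t | v ∈ bag t}).Reachable
              ⟨.inr (φ v), hself v⟩ ⟨.inl t, h⟩ := by
          intro t h
          obtain ⟨e, he, hev⟩ := Finset.mem_image.1 h
          have hmem : ∀ {s}, e ∈ D.bag s → v ∈ bag (.inl s) := fun hs =>
            Finset.mem_image.2 ⟨e, hs, hev⟩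
          let ψ : D.T.induce {s | e ∈ D.bag s} →g
              (D.T.attachLeaves g).induce {t | v ∈ bag t} :=
            ⟨fun s => ⟨.inl s.1, hmem s.2⟩, fun h => h⟩
          have hg : e ∈ D.bag (g (φ v)) := by
            simpa [g] using hf v e (hev ▸ hc e)
          exact (hadj (φ v) (hmem hg)).symm.trans
            (((D.bag_conn e).preconnected ⟨_, hg⟩ ⟨t, he⟩).map ψ)
        refine (connected_iff_exists_forall_reachable _).2 ⟨⟨.inr (φ v), hself v⟩, ?_⟩
        rintro ⟨t | i, h⟩
        · exact hl t h
        · rcases Finset.mem_insert.1 h with hv | hv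
          · obtain rfl : i = φ v := by simp [hv]
            exact .rfl
          · exact (hl _ hv).trans (hadj i hv) }
  refine ⟨D', D'.width_le ?_⟩
  rintro (t | i)
  · exact (Finset.card_image_le.trans (D.card_bag_le t)).trans (Nat.le_succ _)
  · exact (Finset.card_insert_le _ _).trans
      (Nat.succ_le_succ (Finset.card_image_le.trans (D.card_bag_le _)))

end TreeDecomp

/-- For every finite connected simple graph `G` with at least one
edge, `tw(L(G)) ≥ tw(G) − 1`, where `L(G)` is the line graph of `G`. -/
theorem treewidth_lineGraph_ge {V : Type u} [Fintype V] (G : SimpleGraph V)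
    (hconn : G.Connected) (hedge : G.edgeSet.Nonempty) :
    treewidth G - 1 ≤ treewidth G.lineGraph := by
  have := Fintype.ofFinite G.edgeSet
  obtain ⟨D, hD⟩ : treewidth G.lineGraph ∈ {n | ∃ D : TreeDecomp G.lineGraph, D.width = n} :=
    Nat.sInf_mem ⟨_, TreeDecomp.trivial G.lineGraph, rfl⟩
  obtain ⟨D', hD'⟩ := D.exists_width_le_of_lineGraph
  have : treewidth G ≤ D'.width := Nat.sInf_le ⟨D', rfl⟩
  omega
end

section
/- Let G be a finite connected simple graph and let H be a connected subgraph of G. Then dsn(H) ≤ dsn(G). -/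
open SimpleGraph

universe u


/-- An egg of a graph `G`: a nonempty set of vertices inducing a connected subgraph. -/
def SimpleGraph.IsEgg {V : Type u} (G : SimpleGraph V) (A : Finset V) : Prop :=
  A.Nonempty ∧ (G.induce (A : Set V)).Connected

/-- A scramble on `G`: a nonempty finite collection of eggs. -/
def SimpleGraph.IsScramble {V : Type u} (G : SimpleGraph V) (S : Finset (Finset V)) : Prop :=
  S.Nonempty ∧ ∀ A ∈ S, G.IsEgg A

/-- The hitting number `h(S)`: the minimum cardinality of a set of vertices meeting
every egg of `S`. -/
noncomputable def hittingNumber {V : Type u} (S : Finset (Finset V)) : ℕ :=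
  sInf {n | ∃ H : Finset V, H.card = n ∧ ∀ A ∈ S, ∃ x ∈ H, x ∈ A}

/-- The number of edges of `G` with one endpoint in `A` and the other outside of `A`. -/
noncomputable def cutSize {V : Type u} (G : SimpleGraph V) (A : Set V) : ℕ :=
  Set.ncard {e : Sym2 V | ∃ u v, e = s(u, v) ∧ G.Adj u v ∧ u ∈ A ∧ v ∉ A}

/-- An egg-cut for a scramble `S`: a vertex subset `A` containing some egg of `S` and
whose complement contains some egg of `S`. -/
def IsEggCut {V : Type u} (S : Finset (Finset V)) (A : Set V) : Prop :=
  (∃ B ∈ S, (B : Set V) ⊆ A) ∧ (∃ B ∈ S, (B : Set V) ⊆ Aᶜ)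

/-- The egg-cut number `e(S)` (in `ℕ∞`): the minimum size of an egg-cut for `S`,
or `⊤` if no egg-cut exists. -/
noncomputable def eggCutNumber {V : Type u} (G : SimpleGraph V) (S : Finset (Finset V)) : ℕ∞ :=
  sInf {n : ℕ∞ | ∃ A : Set V, IsEggCut S A ∧ n = (cutSize G A : ℕ∞)}

/-- The order `‖S‖` of a scramble: the minimum of its hitting number and
its egg-cut number. -/
noncomputable def scrambleOrder {V : Type u} (G : SimpleGraph V) (S : Finset (Finset V)) : ℕ∞ :=
  min (hittingNumber S : ℕ∞) (eggCutNumber G S)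

/-- The scramble number `sn(G)`: the maximum order of a scramble on `G`. -/
noncomputable def scrambleNumber {V : Type u} (G : SimpleGraph V) : ℕ :=
  sSup {n | ∃ S : Finset (Finset V), G.IsScramble S ∧ scrambleOrder G S = (n : ℕ∞)}

/-- A disjoint scramble: a scramble whose eggs are pairwise disjoint. -/
def IsDisjointScramble {V : Type u} (G : SimpleGraph V) (S : Finset (Finset V)) : Prop :=
  G.IsScramble S ∧ (S : Set (Finset V)).Pairwise fun A B => Disjoint (A : Set V) (B : Set V)

/-- The disjoint scramble number `dsn(G)`: the maximum order of a disjoint scramble on `G`. -/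
noncomputable def disjointScrambleNumber {V : Type u} (G : SimpleGraph V) : ℕ :=
  sSup {n | ∃ S : Finset (Finset V), IsDisjointScramble G S ∧ scrambleOrder G S = (n : ℕ∞)}

/-- The carton number `cart(G)`: the minimum size (number of eggs) of a scramble on `G`
whose order equals the scramble number of `G`. -/
noncomputable def cartonNumber {V : Type u} (G : SimpleGraph V) : ℕ :=
  sInf {n | ∃ S : Finset (Finset V), G.IsScramble S ∧
    scrambleOrder G S = (scrambleNumber G : ℕ∞) ∧ S.card = n}

/-- The maximum degree of a graph. -/
noncomputable def maxDeg {V : Type u} (G : SimpleGraph V) : ℕ :=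
  sSup {n | ∃ v : V, (G.neighborSet v).ncard = n}

/-- The image of an egg under an injective graph homomorphism is an egg. -/
theorem SimpleGraph.IsEgg.map {V W : Type*} {G : SimpleGraph V} {G' : SimpleGraph W}
    (f : Copy G G') {A : Finset V} (hA : G.IsEgg A) : G'.IsEgg (A.map f.toEmbedding) := by
  have hmaps : Set.MapsTo f.toHom (A : Set V) (A.map f.toEmbedding : Finset W) := fun x hx =>
    Finset.mem_coe.2 (Finset.mem_map_of_mem f.toEmbedding hx)
  refine ⟨hA.1.map, hA.2.map (induceHom f.toHom hmaps) ?_⟩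
  rintro ⟨y, hy⟩
  obtain ⟨x, hx, rfl⟩ := Finset.mem_map.1 (Finset.mem_coe.1 hy)
  exact ⟨⟨x, hx⟩, rfl⟩

/-- The image of a collection of vertex sets under an embedding. -/
def mapEggs {V W : Type*} (f : V ↪ W) (S : Finset (Finset V)) : Finset (Finset W) :=
  S.map (Finset.mapEmbedding f).toEmbedding

theorem mem_mapEggs {V W : Type*} {f : V ↪ W} {S : Finset (Finset V)} {B : Finset W} :
    B ∈ mapEggs f S ↔ ∃ A ∈ S, A.map f = B := by
  simp [mapEggs]

theorem IsDisjointScramble.map {V W : Type*} {G : SimpleGraph V} {G' : SimpleGraph W}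
    (f : Copy G G') {S : Finset (Finset V)} (hS : IsDisjointScramble G S) :
    IsDisjointScramble G' (mapEggs f.toEmbedding S) := by
  obtain ⟨⟨hne, hegg⟩, hdisj⟩ := hS
  refine ⟨⟨hne.map, fun B hB => ?_⟩, fun B hB C hC hBC => ?_⟩
  · obtain ⟨A, hA, rfl⟩ := mem_mapEggs.1 hB
    exact (hegg A hA).map f
  · obtain ⟨A, hA, rfl⟩ := mem_mapEggs.1 hB
    obtain ⟨A', hA', rfl⟩ := mem_mapEggs.1 hC
    have hAA' : Disjoint (A : Set V) (A' : Set V) :=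
      hdisj hA hA' fun h => hBC (congrArg _ h)
    exact Finset.disjoint_coe.2 ((Finset.disjoint_map _).2 (Finset.disjoint_coe.1 hAA'))

theorem hittingNumber_le_card {V : Type*} {S : Finset (Finset V)} {X : Finset V}
    (hX : ∀ A ∈ S, ∃ x ∈ X, x ∈ A) : hittingNumber S ≤ X.card :=
  Nat.sInf_le ⟨X, rfl, hX⟩

theorem hittingNumber_le_mapEggs {V W : Type*} [Fintype W] (f : V ↪ W)
    {S : Finset (Finset V)} (hS : ∀ A ∈ S, A.Nonempty) :
    hittingNumber S ≤ hittingNumber (mapEggs f S) := by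
  refine le_csInf ⟨_, Finset.univ, rfl, fun B hB => ?_⟩ ?_
  · obtain ⟨A, hA, rfl⟩ := mem_mapEggs.1 hB
    obtain ⟨x, hx⟩ := (hS A hA).map (f := f)
    exact ⟨x, Finset.mem_univ x, hx⟩
  · rintro _ ⟨X, rfl, hX⟩
    calc hittingNumber S ≤ (X.preimage f f.injective.injOn).card :=
          hittingNumber_le_card fun A hA => by
            obtain ⟨y, hyX, hy⟩ := hX _ (mem_mapEggs.2 ⟨A, hA, rfl⟩)
            obtain ⟨x, hx, rfl⟩ := Finset.mem_map.1 hy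
            exact ⟨x, Finset.mem_preimage.2 hyX, hx⟩
      _ ≤ X.card := Finset.card_le_card_of_injOn f
          (fun x hx => Finset.mem_preimage.1 hx) f.injective.injOn

/-- Pulling a vertex set back along an injective homomorphism does not increase its cut size. -/
theorem cutSize_preimage_le {V W : Type*} [Finite W] {G : SimpleGraph V} {G' : SimpleGraph W}
    (f : Copy G G') (A : Set W) : cutSize G (f ⁻¹' A) ≤ cutSize G' A := by
  refine Set.ncard_le_ncard_of_injOn (Sym2.map f) ?_
    (Sym2.map.injective f.injective).injOn (Set.toFinite _)
  rintro _ ⟨u, v, rfl, huv, hu, hv⟩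
  exact ⟨f u, f v, rfl, f.toHom.map_adj huv, hu, hv⟩

theorem IsEggCut.preimage {V W : Type*} {f : V ↪ W} {S : Finset (Finset V)} {A : Set W}
    (hA : IsEggCut (mapEggs f S) A) : IsEggCut S (f ⁻¹' A) := by
  obtain ⟨⟨B, hB, hBA⟩, C, hC, hCA⟩ := hA
  obtain ⟨B, hB', rfl⟩ := mem_mapEggs.1 hB
  obtain ⟨C, hC', rfl⟩ := mem_mapEggs.1 hC
  exact ⟨⟨B, hB', fun x hx => hBA (Finset.mem_coe.2 (Finset.mem_map_of_mem f hx))⟩,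
    C, hC', fun x hx => hCA (Finset.mem_coe.2 (Finset.mem_map_of_mem f hx))⟩

theorem eggCutNumber_le_mapEggs {V W : Type*} [Finite W] {G : SimpleGraph V}
    {G' : SimpleGraph W} (f : Copy G G') (S : Finset (Finset V)) :
    eggCutNumber G S ≤ eggCutNumber G' (mapEggs f.toEmbedding S) := by
  refine le_sInf ?_
  rintro _ ⟨A, hA, rfl⟩
  exact sInf_le_of_le ⟨_, hA.preimage, rfl⟩ (Nat.cast_le.2 (cutSize_preimage_le f A))

theorem scrambleOrder_le_mapEggs {V W : Type*} [Fintype W] {G : SimpleGraph V}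
    {G' : SimpleGraph W} (f : Copy G G') {S : Finset (Finset V)} (hS : G.IsScramble S) :
    scrambleOrder G S ≤ scrambleOrder G' (mapEggs f.toEmbedding S) :=
  min_le_min (Nat.cast_le.2 (hittingNumber_le_mapEggs _ fun A hA => (hS.2 A hA).1))
    (eggCutNumber_le_mapEggs f S)

theorem scrambleOrder_le_card {V : Type*} [Fintype V] {G : SimpleGraph V}
    {S : Finset (Finset V)} (hS : G.IsScramble S) : scrambleOrder G S ≤ Fintype.card V := by
  refine (min_le_left _ _).trans (Nat.cast_le.2 (hittingNumber_le_card fun A hA => ?_))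
  obtain ⟨x, hx⟩ := (hS.2 A hA).1
  exact ⟨x, Finset.mem_univ x, hx⟩

theorem scrambleOrder_le_disjointScrambleNumber {V : Type*} [Fintype V] {G : SimpleGraph V}
    {S : Finset (Finset V)} (hS : IsDisjointScramble G S) :
    scrambleOrder G S ≤ disjointScrambleNumber G := by
  obtain ⟨n, hn⟩ := ENat.ne_top_iff_exists.1
    (ne_top_of_le_ne_top (ENat.natCast_ne_top _) (scrambleOrder_le_card hS.1))
  rw [← hn, Nat.cast_le]
  refine le_csSup ⟨Fintype.card V, ?_⟩ ⟨S, hS, hn.symm⟩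
  rintro m ⟨T, hT, hm⟩
  exact Nat.cast_le.1 (hm ▸ scrambleOrder_le_card hT.1)

/-- The disjoint scramble number is monotone under injective graph homomorphisms. -/
theorem disjointScrambleNumber_le_of_copy {V W : Type*} [Fintype W] {G : SimpleGraph V}
    {G' : SimpleGraph W} (f : Copy G G') :
    disjointScrambleNumber G ≤ disjointScrambleNumber G' := by
  refine csSup_le' ?_
  rintro n ⟨S, hS, hn⟩
  rw [← Nat.cast_le (α := ℕ∞), ← hn]
  exact (scrambleOrder_le_mapEggs f hS.1).trans
    (scrambleOrder_le_disjointScrambleNumber (hS.map f))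

/-- If `H` is a connected subgraph of a finite connected simple graph
`G`, then `dsn(H) ≤ dsn(G)`. -/
theorem dsn_subgraph_le {V : Type u} [Fintype V] (G : SimpleGraph V)
    (hconn : G.Connected) (H : G.Subgraph) (hH : H.coe.Connected) :
    disjointScrambleNumber H.coe ≤ disjointScrambleNumber G :=
  disjointScrambleNumber_le_of_copy ⟨H.hom, H.hom_injective⟩
end

section
/- Let k ≥ 1 and let G be a finite simple graph that is k-connected. Then dsn(G) ≥ k. -/
open SimpleGraph

universe u


/-- The cut size of `A` counts the ordered adjacent pairs leaving `A`. -/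
theorem cutSize_eq_ncard_pairs {V : Type u} (G : SimpleGraph V) (A : Set V) :
    cutSize G A = {p : V × V | G.Adj p.1 p.2 ∧ p.1 ∈ A ∧ p.2 ∉ A}.ncard := by
  have himage : {e : Sym2 V | ∃ u v, e = s(u, v) ∧ G.Adj u v ∧ u ∈ A ∧ v ∉ A} =
      (fun p : V × V => s(p.1, p.2)) '' {p | G.Adj p.1 p.2 ∧ p.1 ∈ A ∧ p.2 ∉ A} := by
    ext e
    constructor
    · rintro ⟨u, v, rfl, h⟩
      exact ⟨(u, v), h, rfl⟩
    · rintro ⟨p, h, rfl⟩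
      exact ⟨p.1, p.2, rfl, h⟩
  rw [cutSize, himage, Set.InjOn.ncard_image]
  rintro ⟨a, b⟩ ⟨-, ha, -⟩ ⟨c, d⟩ ⟨-, -, hd⟩ h
  rcases Sym2.eq_iff.mp h with ⟨rfl, rfl⟩ | ⟨rfl, rfl⟩
  · rfl
  · exact absurd ha hd

/-- A connected graph has an edge leaving any set that separates two of its vertices. -/
theorem SimpleGraph.Connected.exists_adj_mem_notMem {W : Type*} {H : SimpleGraph W}
    (hH : H.Connected) {A : Set W} {x y : W} (hx : x ∈ A) (hy : y ∉ A) :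
    ∃ u v, H.Adj u v ∧ u ∈ A ∧ v ∉ A := by
  obtain ⟨p⟩ := hH.preconnected x y
  obtain ⟨d, -, hu, hv⟩ := p.exists_boundary_dart A hx hy
  exact ⟨d.fst, d.snd, d.adj, hu, hv⟩

/-- A `k`-connected graph is `k`-edge-connected: every nontrivial cut has at least `k` edges. -/
theorem le_cutSize_of_kconnected {V : Type u} [Fintype V] (G : SimpleGraph V) {k : ℕ}
    (hcard : k + 1 ≤ Fintype.card V)
    (hconn : ∀ T : Set V, T.ncard < k → (G.induce Tᶜ).Connected)
    {A : Set V} (hA : A.Nonempty) (hAc : Aᶜ.Nonempty) : k ≤ cutSize G A := by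
  classical
  rw [cutSize_eq_ncard_pairs]
  set P : Set (V × V) := {p | G.Adj p.1 p.2 ∧ p.1 ∈ A ∧ p.2 ∉ A} with hP
  by_cases hfull : ∀ x ∈ A, ∀ y ∉ A, G.Adj x y
  · have hprod : P = A ×ˢ Aᶜ := by
      ext ⟨x, y⟩
      exact ⟨fun h => h.2, fun h => ⟨hfull x h.1 y h.2, h⟩⟩
    rw [hprod, Set.ncard_prod]
    have hsum : A.ncard + Aᶜ.ncard = Fintype.card V := by
      rw [Set.ncard_add_ncard_compl, Nat.card_eq_fintype_card]
    have hApos : 0 < A.ncard := (Set.ncard_pos).mpr hA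
    have hAcpos : 0 < Aᶜ.ncard := (Set.ncard_pos).mpr hAc
    nlinarith
  · push Not at hfull
    obtain ⟨x, hx, y, hy, hxy⟩ := hfull
    by_contra! hlt
    let f : V × V → V := fun p => if p.1 = x then p.2 else p.1
    have hT : (f '' P).ncard < k := (Set.ncard_image_le P.toFinite).trans_lt hlt
    have hxT : x ∉ f '' P := by
      rintro ⟨⟨u, v⟩, ⟨-, -, hv⟩, h⟩
      by_cases hu : u = x
      · exact hv ((if_pos hu).symm.trans h ▸ hx)
      · exact hu ((if_neg hu).symm.trans h)
    have hyT : y ∉ f '' P := by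
      rintro ⟨⟨u, v⟩, ⟨huv, hu, -⟩, h⟩
      by_cases hux : u = x
      · exact hxy (hux ▸ (if_pos hux).symm.trans h ▸ huv)
      · exact hy ((if_neg hux).symm.trans h ▸ hu)
    obtain ⟨⟨u, hu⟩, ⟨v, hv⟩, huv, huA, hvA⟩ :=
      (hconn _ hT).exists_adj_mem_notMem (A := Subtype.val ⁻¹' A)
        (x := ⟨x, hxT⟩) (y := ⟨y, hyT⟩) hx hy
    have hf : f (u, v) ∈ f '' P := ⟨(u, v), ⟨huv, huA, hvA⟩, rfl⟩
    by_cases hux : u = x <;> simp only [f, hux, if_true, if_false] at hf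
    · exact hv hf
    · exact hu hf

/-- The hitting number of a scramble is at most the number of vertices. -/
theorem SimpleGraph.IsScramble.hittingNumber_le_card {V : Type u} [Fintype V]
    {G : SimpleGraph V} {S : Finset (Finset V)} (hS : G.IsScramble S) :
    hittingNumber S ≤ Fintype.card V :=
  Nat.sInf_le ⟨Finset.univ, Finset.card_univ, fun A hA =>
    (hS.2 A hA).1.imp fun x hx => ⟨Finset.mem_univ x, hx⟩⟩

/-- The order of every disjoint scramble is a lower bound for the disjoint scramble number. -/
theorem le_disjointScrambleNumber {V : Type u} [Fintype V] {G : SimpleGraph V}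
    {S : Finset (Finset V)} (hS : IsDisjointScramble G S) {k : ℕ}
    (hk : (k : ℕ∞) ≤ scrambleOrder G S) : k ≤ disjointScrambleNumber G := by
  have hbdd : BddAbove
      {n : ℕ | ∃ S, IsDisjointScramble G S ∧ scrambleOrder G S = (n : ℕ∞)} := by
    refine ⟨Fintype.card V, ?_⟩
    rintro n ⟨S, hS, hn⟩
    have h : (n : ℕ∞) ≤ hittingNumber S := hn ▸ min_le_left _ _
    exact (Nat.cast_le.mp h).trans hS.1.hittingNumber_le_card
  obtain ⟨n, hn⟩ := ENat.ne_top_iff_exists.mp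
    (ne_top_of_le_ne_top (ENat.natCast_ne_top _) (min_le_left _ _) : scrambleOrder G S ≠ ⊤)
  rw [← hn, Nat.cast_le] at hk
  exact hk.trans (le_csSup hbdd ⟨S, hS, hn.symm⟩)

/-- The scramble whose eggs are all the single vertices. -/
def singletonScramble (V : Type u) [Fintype V] : Finset (Finset V) :=
  Finset.univ.map ⟨singleton, Finset.singleton_injective⟩

theorem mem_singletonScramble {V : Type u} [Fintype V] {A : Finset V} :
    A ∈ singletonScramble V ↔ ∃ v, {v} = A := by
  simp [singletonScramble]

theorem isDisjointScramble_singletonScramble {V : Type u} [Fintype V] [Nonempty V]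
    (G : SimpleGraph V) : IsDisjointScramble G (singletonScramble V) := by
  refine ⟨⟨?_, fun A hA => ?_⟩, fun A hA B hB hAB => ?_⟩
  · exact ⟨{Classical.arbitrary V}, mem_singletonScramble.mpr ⟨_, rfl⟩⟩
  · obtain ⟨v, rfl⟩ := mem_singletonScramble.mp hA
    refine ⟨Finset.singleton_nonempty v, ?_⟩
    rw [Finset.coe_singleton]
    exact SimpleGraph.Connected.of_subsingleton
  · obtain ⟨v, rfl⟩ := mem_singletonScramble.mp hA
    obtain ⟨w, rfl⟩ := mem_singletonScramble.mp hB
    rw [Finset.disjoint_coe, Finset.disjoint_singleton]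
    exact fun h => hAB (h ▸ rfl)

theorem card_le_hittingNumber_singletonScramble (V : Type u) [Fintype V] :
    Fintype.card V ≤ hittingNumber (singletonScramble V) := by
  refine le_csInf ⟨_, Finset.univ, rfl, fun A hA => ?_⟩ ?_
  · obtain ⟨v, rfl⟩ := mem_singletonScramble.mp hA
    exact ⟨v, Finset.mem_univ v, Finset.mem_singleton_self v⟩
  · rintro n ⟨H, rfl, hH⟩
    have huniv : H = Finset.univ := Finset.eq_univ_iff_forall.mpr fun v => by
      obtain ⟨x, hx, hxv⟩ := hH {v} (mem_singletonScramble.mpr ⟨v, rfl⟩)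
      exact Finset.mem_singleton.mp hxv ▸ hx
    rw [huniv, Finset.card_univ]

theorem IsEggCut.nonempty {V : Type u} {G : SimpleGraph V} {S : Finset (Finset V)}
    (hS : G.IsScramble S) {A : Set V} (hA : IsEggCut S A) : A.Nonempty ∧ Aᶜ.Nonempty := by
  obtain ⟨⟨B, hB, hBA⟩, C, hC, hCA⟩ := hA
  exact ⟨(Finset.coe_nonempty.mpr (hS.2 B hB).1).mono hBA,
    (Finset.coe_nonempty.mpr (hS.2 C hC).1).mono hCA⟩

/-- If `G` is a finite simple graph that is `k`-connected (for `k ≥ 1`),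
i.e. `|V(G)| ≥ k + 1` and removing fewer than `k` vertices leaves an induced subgraph
that is connected, then `dsn(G) ≥ k`. -/
theorem dsn_ge_of_kconnected {V : Type u} [Fintype V] (G : SimpleGraph V)
    (k : ℕ) (hk : 1 ≤ k) (hcard : k + 1 ≤ Fintype.card V)
    (hconn : ∀ T : Set V, T.ncard < k → (G.induce Tᶜ).Connected) :
    k ≤ disjointScrambleNumber G := by
  have : Nonempty V := Fintype.card_pos_iff.mp (by lia)
  have hS := isDisjointScramble_singletonScramble G
  refine le_disjointScrambleNumber hS (le_min ?_ (le_sInf ?_))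
  · have := card_le_hittingNumber_singletonScramble V
    exact Nat.cast_le.mpr (by lia)
  · rintro n ⟨A, hA, rfl⟩
    obtain ⟨hne, hnec⟩ := hA.nonempty hS.1
    exact Nat.cast_le.mpr (le_cutSize_of_kconnected G hcard hconn hne hnec)
end

section
/- Let G be a finite connected simple graph on n ≥ 2 vertices with maximum degree Δ(G). Then dsn(G)² ≤ n·Δ(G). -/
open SimpleGraph

universe u


section

variable {V : Type u}

theorem ncard_neighborSet_le_maxDeg [Finite V] (G : SimpleGraph V) (v : V) :
    (G.neighborSet v).ncard ≤ maxDeg G := by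
  refine le_csSup ⟨Nat.card V, ?_⟩ ⟨v, rfl⟩
  rintro _ ⟨w, rfl⟩
  exact Set.ncard_le_card _

theorem maxDeg_pos [Finite V] [Nontrivial V] {G : SimpleGraph V} (hconn : G.Connected) :
    0 < maxDeg G := by
  obtain ⟨v⟩ := hconn.nonempty
  obtain ⟨w, hw⟩ := hconn.preconnected.exists_adj_of_nontrivial v
  exact ((Set.ncard_pos (Set.toFinite _)).2 ⟨w, hw⟩).trans_le (ncard_neighborSet_le_maxDeg G v)

theorem cutSize_le_card_mul_maxDeg [Finite V] (G : SimpleGraph V) (A : Finset V) :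
    cutSize G A ≤ A.card * maxDeg G := by
  classical
  have := Fintype.ofFinite V
  have hsub : {e : Sym2 V | ∃ u v, e = s(u, v) ∧ G.Adj u v ∧ u ∈ (A : Set V) ∧ v ∉ (A : Set V)} ⊆
      (A.biUnion fun u => (G.neighborSet u).toFinset.image fun v => s(u, v) : Finset (Sym2 V)) := by
    rintro _ ⟨u, v, rfl, huv, hu, -⟩
    simp only [Finset.coe_biUnion, Set.mem_iUnion]
    exact ⟨u, hu, by simpa using ⟨v, huv, Or.inl rfl⟩⟩
  refine (Set.ncard_le_ncard hsub (Finset.finite_toSet _)).trans ?_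
  rw [Set.ncard_coe_finset]
  refine Finset.card_biUnion_le_card_mul _ _ _ fun u _ => Finset.card_image_le.trans ?_
  rw [← Set.ncard_eq_toFinset_card']
  exact ncard_neighborSet_le_maxDeg G u

theorem hittingNumber_le_card_s17 {S : Finset (Finset V)} (hS : ∀ A ∈ S, A.Nonempty) :
    hittingNumber S ≤ S.card := by
  classical
  choose f hf using hS
  have hle : hittingNumber S ≤ (S.attach.image fun A => f A.1 A.2).card :=
    Nat.sInf_le ⟨_, rfl, fun A hA =>
      ⟨f A hA, Finset.mem_image.2 ⟨⟨A, hA⟩, Finset.mem_attach _ _, rfl⟩, hf A hA⟩⟩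
  exact hle.trans (Finset.card_image_le.trans_eq S.card_attach)

theorem eggCutNumber_le_cutSize (G : SimpleGraph V) {S : Finset (Finset V)}
    (hdisj : (S : Set (Finset V)).Pairwise fun A B => Disjoint (A : Set V) (B : Set V))
    {A B : Finset V} (hA : A ∈ S) (hB : B ∈ S) (hAB : A ≠ B) :
    eggCutNumber G S ≤ (cutSize G A : ℕ∞) :=
  sInf_le ⟨A, ⟨⟨A, hA, subset_rfl⟩, B, hB, (hdisj hA hB hAB).subset_compl_left⟩, rfl⟩

theorem sq_le_card_mul_maxDeg_of_scrambleOrder_eq [Fintype V] [Nontrivial V] {G : SimpleGraph V}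
    (hconn : G.Connected) {S : Finset (Finset V)} (hS : IsDisjointScramble G S) {k : ℕ}
    (hk : scrambleOrder G S = k) : k ^ 2 ≤ Fintype.card V * maxDeg G := by
  classical
  obtain ⟨⟨-, hegg⟩, hdisj⟩ := hS
  have hkS : k ≤ S.card := by
    have h : (k : ℕ∞) ≤ hittingNumber S := hk ▸ min_le_left _ _
    exact (Nat.cast_le.1 h).trans (hittingNumber_le_card_s17 fun A hA => (hegg A hA).1)
  rcases le_or_gt S.card 1 with h1 | h1
  · have hpos : 0 < Fintype.card V * maxDeg G :=
      Nat.mul_pos Fintype.card_pos (maxDeg_pos hconn)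
    have hk1 : k ^ 2 ≤ 1 := Nat.pow_le_one_iff two_ne_zero |>.2 (hkS.trans h1)
    exact hk1.trans hpos
  have hcut : ∀ A ∈ S, k ≤ A.card * maxDeg G := by
    intro A hA
    obtain ⟨B, hB, hBA⟩ := Finset.exists_mem_ne h1 A
    have h : (k : ℕ∞) ≤ cutSize G A :=
      hk ▸ (min_le_right _ _).trans (eggCutNumber_le_cutSize G hdisj hA hB hBA.symm)
    exact (Nat.cast_le.1 h).trans (cutSize_le_card_mul_maxDeg G A)
  have hsum : ∑ A ∈ S, A.card ≤ Fintype.card V := by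
    have h := Finset.card_biUnion (s := S) (t := id) fun A hA B hB hAB =>
      Finset.disjoint_coe.1 (hdisj hA hB hAB)
    exact h.symm.trans_le (Finset.card_le_univ _)
  calc k ^ 2 = k * k := sq k
    _ ≤ S.card * k := Nat.mul_le_mul_right k hkS
    _ ≤ ∑ A ∈ S, A.card * maxDeg G := by
      simpa using Finset.card_nsmul_le_sum S _ k hcut
    _ = (∑ A ∈ S, A.card) * maxDeg G := (Finset.sum_mul _ _ _).symm
    _ ≤ Fintype.card V * maxDeg G := Nat.mul_le_mul_right _ hsum

end

/-- For every finite connected simple graph `G` on `n ≥ 2` vertices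
with maximum degree `Δ(G)`, we have `dsn(G)² ≤ n·Δ(G)`. -/
theorem dsn_sq_le_card_mul_maxDeg {V : Type u} [Fintype V] (G : SimpleGraph V)
    (hconn : G.Connected) (hcard : 2 ≤ Fintype.card V) :
    disjointScrambleNumber G ^ 2 ≤ Fintype.card V * maxDeg G := by
  have := Fintype.one_lt_card_iff_nontrivial.1 hcard
  have hle : ∀ k ∈ {n : ℕ | ∃ S : Finset (Finset V), IsDisjointScramble G S ∧
      scrambleOrder G S = (n : ℕ∞)}, k ^ 2 ≤ Fintype.card V * maxDeg G :=
    fun _ ⟨_, hS, hk⟩ => sq_le_card_mul_maxDeg_of_scrambleOrder_eq hconn hS hk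
  unfold disjointScrambleNumber
  rcases Set.eq_empty_or_nonempty {n : ℕ | ∃ S : Finset (Finset V), IsDisjointScramble G S ∧
      scrambleOrder G S = (n : ℕ∞)} with h | h
  · simp [h]
  · exact hle _ (Nat.sSup_mem h ⟨_, fun k hk => (Nat.le_self_pow two_ne_zero k).trans (hle k hk)⟩)
end

section
/- Let G and H be finite connected simple graphs with |V(H)| ≥ 2. Then dsn(G □ H) ≥ min(|V(H)|, |V(G)|·λ(H)), where G □ H denotes the Cartesian (box) product of G and H and λ(H) is the edge connectivity of H. -/
open SimpleGraph

universe u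


/-- The edge connectivity of a graph: the minimum number of edges whose deletion
disconnects the graph. -/
noncomputable def edgeConnectivity {W : Type u} (H : SimpleGraph W) : ℕ :=
  sInf {n | ∃ E : Set (Sym2 W), E ⊆ H.edgeSet ∧ ¬ (H.deleteEdges E).Connected ∧
    E.ncard = n}

/-- If `B` separates two vertices, then the edges leaving `B` disconnect the graph. -/
theorem edgeConnectivity_le_cutSize {W : Type u} (H : SimpleGraph W) {B : Set W} {x y : W}
    (hx : x ∈ B) (hy : y ∉ B) : edgeConnectivity H ≤ cutSize H B := by
  refine Nat.sInf_le ⟨{e | ∃ u v, e = s(u, v) ∧ H.Adj u v ∧ u ∈ B ∧ v ∉ B}, ?_, ?_, rfl⟩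
  · rintro _ ⟨u, v, rfl, h, -⟩
    exact h
  · intro h
    obtain ⟨p⟩ := h.preconnected x y
    obtain ⟨d, -, h₁, h₂⟩ := p.exists_boundary_dart B hx hy
    have hd := d.adj
    rw [deleteEdges_adj] at hd
    exact hd.2 ⟨_, _, rfl, hd.1, h₁, h₂⟩

/-- The cut of a subset of a box product contains the cuts of all its slices. -/
theorem sum_cutSize_slice_le_cutSize_boxProd {V W : Type u} [Fintype V] [Finite W]
    (G : SimpleGraph V) (H : SimpleGraph W) (A : Set (V × W)) :
    ∑ v, cutSize H {w | (v, w) ∈ A} ≤ cutSize (G □ H) A := by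
  classical
  have := Fintype.ofFinite W
  have hinj (v : V) : Function.Injective (Sym2.map (Prod.mk v : W → V × W)) :=
    Sym2.map.injective (Prod.mk_right_injective v)
  let C (v : V) : Set (Sym2 W) :=
    {e | ∃ a b, e = s(a, b) ∧ H.Adj a b ∧ (v, a) ∈ A ∧ (v, b) ∉ A}
  let F (v : V) : Finset (Sym2 (V × W)) := (C v).toFinset.image (Sym2.map (Prod.mk v))
  have hF (v : V) : (F v).card = cutSize H {w | (v, w) ∈ A} := by
    rw [Finset.card_image_of_injective _ (hinj v), ← Set.ncard_eq_toFinset_card']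
    rfl
  have hdisj : ∀ v ∈ Finset.univ, ∀ v' ∈ Finset.univ, v ≠ v' → Disjoint (F v) (F v') := by
    intro v _ v' _ hne
    rw [Finset.disjoint_left]
    intro e he he'
    obtain ⟨e₁, -, rfl⟩ := Finset.mem_image.1 he
    obtain ⟨e₂, -, h⟩ := Finset.mem_image.1 he'
    induction e₁ with | _ a b
    induction e₂ with | _ c d
    simp only [Sym2.map_mk, Sym2.eq_iff, Prod.mk.injEq] at h
    grind
  simp_rw [← hF]
  rw [← Finset.card_biUnion hdisj, ← Set.ncard_coe_finset]
  refine Set.ncard_le_ncard ?_ (Set.toFinite _)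
  intro e he
  simp only [Finset.coe_biUnion, Set.mem_iUnion] at he
  obtain ⟨v, -, he⟩ := he
  obtain ⟨_, he₁, rfl⟩ := Finset.mem_image.1 he
  obtain ⟨a, b, rfl, hab, ha, hb⟩ := Set.mem_toFinset.1 he₁
  exact ⟨(v, a), (v, b), rfl, by simpa using hab, ha, hb⟩

/-- Every set of vertices meeting all eggs of a disjoint family is at least as large as the
family. -/
theorem card_le_hittingNumber {V : Type u} [Fintype V] {G : SimpleGraph V}
    {S : Finset (Finset V)} (hS : IsDisjointScramble G S) : S.card ≤ hittingNumber S := by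
  refine le_csInf ⟨_, Finset.univ, rfl, fun A hA ↦ ?_⟩ ?_
  · obtain ⟨x, hx⟩ := (hS.1.2 A hA).1
    exact ⟨x, Finset.mem_univ x, hx⟩
  · rintro _ ⟨T, rfl, hT⟩
    obtain ⟨A₀, hA₀⟩ := hS.1.1
    have : Nonempty V := ⟨(hS.1.2 A₀ hA₀).1.choose⟩
    choose! f hfT hfA using hT
    refine Finset.card_le_card_of_injOn f hfT fun A hA B hB h ↦ ?_
    by_contra hne
    exact Set.disjoint_left.1 (hS.2 hA hB hne) (hfA A hA) (h ▸ hfA B hB)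

/-- The fibre of `V × W` over `w : W`. -/
def rowFiber (V : Type u) {W : Type u} [Fintype V] (w : W) : Finset (V × W) :=
  Finset.univ.map ⟨fun v ↦ (v, w), Prod.mk_left_injective w⟩

theorem mem_rowFiber {V W : Type u} [Fintype V] {w : W} {p : V × W} :
    p ∈ rowFiber V w ↔ p.2 = w := by
  obtain ⟨v, w'⟩ := p
  simp [rowFiber, eq_comm]

theorem rowFiber_injective (V : Type u) {W : Type u} [Fintype V] [Nonempty V] :
    Function.Injective (rowFiber V : W → Finset (V × W)) := by
  intro w w' h
  obtain ⟨v⟩ := ‹Nonempty V›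
  have hv : (v, w) ∈ rowFiber V w := mem_rowFiber.2 rfl
  rw [h] at hv
  exact mem_rowFiber.1 hv

theorem isEgg_rowFiber {V W : Type u} [Fintype V] {G : SimpleGraph V} (H : SimpleGraph W)
    (hG : G.Connected) (w : W) : (G □ H).IsEgg (rowFiber V w) := by
  refine ⟨?_, ?_⟩
  · obtain ⟨v⟩ := hG.nonempty
    exact ⟨(v, w), mem_rowFiber.2 rfl⟩
  · let f : G →g (G □ H).induce (rowFiber V w : Set (V × W)) :=
      ⟨fun v ↦ ⟨(v, w), mem_rowFiber.2 rfl⟩, fun h ↦ by simpa using h⟩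
    refine hG.map f ?_
    rintro ⟨⟨v, w'⟩, hp⟩
    obtain rfl := mem_rowFiber.1 hp
    exact ⟨v, rfl⟩

/-- For finite connected simple graphs `G` and `H` with `|V(H)| ≥ 2`,
`dsn(G □ H) ≥ min(|V(H)|, |V(G)|·λ(H))`. -/
theorem dsn_boxProd_ge {V W : Type u} [Fintype V] [Fintype W]
    (G : SimpleGraph V) (H : SimpleGraph W) (hG : G.Connected) (hH : H.Connected)
    (hW : 2 ≤ Fintype.card W) :
    min (Fintype.card W) (Fintype.card V * edgeConnectivity H) ≤
      disjointScrambleNumber (G □ H) := by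
  classical
  have := hG.nonempty
  obtain ⟨w₀⟩ := hH.nonempty
  have hcard : (Finset.univ.image (rowFiber V : W → Finset (V × W))).card = Fintype.card W := by
    rw [Finset.card_image_of_injective _ (rowFiber_injective V), Finset.card_univ]
  have hS : IsDisjointScramble (G □ H) (Finset.univ.image (rowFiber V)) := by
    refine ⟨⟨⟨_, Finset.mem_image_of_mem _ (Finset.mem_univ w₀)⟩, fun A hA ↦ ?_⟩, ?_⟩
    · obtain ⟨w, -, rfl⟩ := Finset.mem_image.1 hA
      exact isEgg_rowFiber H hG w
    · intro A hA B hB hne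
      obtain ⟨w, -, rfl⟩ := Finset.mem_image.1 hA
      obtain ⟨w', -, rfl⟩ := Finset.mem_image.1 hB
      refine Set.disjoint_left.2 fun p hp hp' ↦ hne ?_
      rw [← mem_rowFiber.1 hp, ← mem_rowFiber.1 hp']
  refine le_disjointScrambleNumber hS (le_min ?_ (le_sInf ?_))
  · exact Nat.cast_le.2 ((min_le_left _ _).trans (hcard ▸ card_le_hittingNumber hS))
  · rintro _ ⟨A, ⟨⟨B, hB, hBA⟩, ⟨B', hB', hBA'⟩⟩, rfl⟩
    obtain ⟨w, -, rfl⟩ := Finset.mem_image.1 hB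
    obtain ⟨w', -, rfl⟩ := Finset.mem_image.1 hB'
    refine Nat.cast_le.2 ((min_le_right _ _).trans ?_)
    calc Fintype.card V * edgeConnectivity H
        = ∑ _v : V, edgeConnectivity H := by simp
      _ ≤ ∑ v, cutSize H {w | (v, w) ∈ A} := Finset.sum_le_sum fun v _ ↦
          edgeConnectivity_le_cutSize H (x := w) (y := w')
            (hBA (mem_rowFiber.2 rfl)) (hBA' (mem_rowFiber.2 rfl))
      _ ≤ cutSize (G □ H) A := sum_cutSize_slice_le_cutSize_boxProd G H A
end

section
/- For every k ≥ 1, let G_k be the simple graph with vertex set {1, 2, …, 4k} in which distinct vertices i and j are adjacent if and only if |i − j| ≤ k. Then dsn(G_k) ≥ 2k − 1 and tw(G_k) = k; in particular dsn(G_k) − tw(G_k) ≥ k − 1. -/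
open SimpleGraph

universe u


namespace SimpleGraph

variable {V : Type u} {G : SimpleGraph V}

/-- Two adjacent vertices separated by `A`, together with their common neighbours, force many
edges across the cut. -/
lemma card_add_one_le_cutSize [Finite V] {A : Set V} {a b : V} (hab : G.Adj a b)
    (ha : a ∈ A) (hb : b ∉ A) (N : Finset V) (hN : ∀ w ∈ N, G.Adj w a ∧ G.Adj w b) :
    N.card + 1 ≤ cutSize G A := by
  classical
  have hbN : b ∉ N := fun h => (hN b h).2.ne rfl
  let f : V → Sym2 V := fun w => if w ∈ A then s(w, b) else s(w, a)
  have hinj : Set.InjOn f (insert b N : Finset V) := by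
    intro x hx y hy hxy
    have hne : ∀ z ∈ insert b N, z ≠ a := by
      intro z hz
      rcases Finset.mem_insert.1 hz with rfl | hz
      · exact hab.ne'
      · exact (hN z hz).1.ne
    have hxa := hne x (by simpa using hx)
    have hya := hne y (by simpa using hy)
    simp only [f] at hxy
    split_ifs at hxy <;> simp only [Sym2.eq_iff] at hxy <;> grind
  rw [← Finset.card_insert_of_notMem hbN, ← Finset.card_image_of_injOn hinj,
    ← Set.ncard_coe_finset, cutSize]
  refine Set.ncard_le_ncard ?_ (Set.toFinite _)
  intro e he
  simp only [Finset.coe_image, Set.mem_image, Finset.mem_coe, Finset.mem_insert] at he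
  obtain ⟨w, hw, rfl⟩ := he
  by_cases hwA : w ∈ A
  · have hwN : w ∈ N := hw.resolve_left (by rintro rfl; exact hb hwA)
    exact ⟨w, b, by simp [f, hwA], (hN w hwN).2, hwA, hb⟩
  · refine ⟨a, w, by simp [f, hwA, Sym2.eq_swap], ?_, ha, hwA⟩
    rcases hw with rfl | hw
    · exact hab
    · exact (hN w hw).1.symm

lemma hittingNumber_le_card [Fintype V] {S : Finset (Finset V)} (hS : ∀ A ∈ S, A.Nonempty) :
    hittingNumber S ≤ Fintype.card V :=
  Nat.sInf_le ⟨Finset.univ, rfl, fun A hA => (hS A hA).imp fun x hx => ⟨Finset.mem_univ x, hx⟩⟩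

lemma le_disjointScrambleNumber [Fintype V] {S : Finset (Finset V)} (hS : IsDisjointScramble G S)
    {n : ℕ} (hn : n ≤ scrambleOrder G S) : n ≤ disjointScrambleNumber G := by
  have hbound : ∀ S, IsDisjointScramble G S → scrambleOrder G S ≤ Fintype.card V := fun S hS =>
    (min_le_left _ _).trans (by exact_mod_cast hittingNumber_le_card fun A hA => (hS.1.2 A hA).1)
  obtain ⟨m, hm⟩ := ENat.ne_top_iff_exists.1 (ne_top_of_le_ne_top (ENat.natCast_ne_top _) (hbound S hS))
  have hnm : n ≤ m := by rw [← hm] at hn; exact_mod_cast hn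
  refine hnm.trans (le_csSup ⟨Fintype.card V, ?_⟩ ⟨S, hS, hm.symm⟩)
  rintro l ⟨S', hS', hl⟩
  exact_mod_cast hl ▸ hbound S' hS'

/-- The scramble whose eggs are the singletons of elements of `M`. -/
noncomputable def singletonScramble (M : Finset V) : Finset (Finset V) :=
  M.map ⟨singleton, Finset.singleton_injective⟩

lemma isDisjointScramble_singletonScramble {M : Finset V} (hM : M.Nonempty) :
    IsDisjointScramble G (singletonScramble M) := by
  refine ⟨⟨by simpa [singletonScramble] using hM, ?_⟩, ?_⟩
  · intro A hA
    obtain ⟨x, -, rfl⟩ := Finset.mem_map.1 hA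
    refine ⟨Finset.singleton_nonempty x, ?_⟩
    have : Subsingleton ↥(↑({x} : Finset V) : Set V) := by simp
    have : Nonempty ↥(↑({x} : Finset V) : Set V) := ⟨⟨x, by simp⟩⟩
    exact IsTree.of_subsingleton.connected
  · intro A hA B hB hAB
    obtain ⟨x, -, rfl⟩ := Finset.mem_map.1 (Finset.mem_coe.1 hA)
    obtain ⟨y, -, rfl⟩ := Finset.mem_map.1 (Finset.mem_coe.1 hB)
    simpa using fun h => hAB (by simp [h])

lemma card_le_hittingNumber_singletonScramble (M : Finset V) :
    M.card ≤ hittingNumber (singletonScramble M) := by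
  have hne : {n | ∃ H : Finset V, H.card = n ∧
      ∀ A ∈ singletonScramble M, ∃ x ∈ H, x ∈ A}.Nonempty :=
    ⟨_, M, rfl, by simp [singletonScramble]⟩
  refine le_csInf hne ?_
  rintro n ⟨H, rfl, hH⟩
  refine Finset.card_le_card fun x hx => ?_
  simpa using hH {x} (by simpa [singletonScramble] using hx)

lemma le_eggCutNumber_singletonScramble {M : Finset V} {n : ℕ}
    (h : ∀ A : Set V, ∀ x ∈ M, ∀ y ∈ M, x ∈ A → y ∉ A → n ≤ cutSize G A) :
    (n : ℕ∞) ≤ eggCutNumber G (singletonScramble M) := by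
  refine le_sInf ?_
  rintro _ ⟨A, ⟨⟨B, hB, hBA⟩, ⟨C, hC, hCA⟩⟩, rfl⟩
  obtain ⟨x, hx, rfl⟩ := Finset.mem_map.1 hB
  obtain ⟨y, hy, rfl⟩ := Finset.mem_map.1 hC
  exact_mod_cast h A x hx y hy (by simpa using hBA) (by simpa using hCA)

/-- If the vertices of an interval are split by a set, two consecutive ones are. -/
lemma exists_consecutive_split {P : ℕ → Prop} {x y : ℕ} (hxy : x ≤ y) (h : ¬(P x ↔ P y)) :
    ∃ i, x ≤ i ∧ i + 1 ≤ y ∧ ¬(P i ↔ P (i + 1)) := by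
  induction y, hxy using Nat.le_induction with
  | base => exact absurd Iff.rfl h
  | succ y hxy ih =>
    by_cases hy : P x ↔ P y
    · exact ⟨y, hxy, le_rfl, fun h' => h (hy.trans h')⟩
    · obtain ⟨i, h1, h2, h3⟩ := ih hy
      exact ⟨i, h1, h2.trans (Nat.le_succ y), h3⟩

theorem le_disjointScrambleNumber_of_band {k : ℕ} (hk : 1 ≤ k) {G : SimpleGraph (Fin (4 * k))}
    (hG : ∀ i j : Fin (4 * k), G.Adj i j ↔ i ≠ j ∧ |(i : ℤ) - (j : ℤ)| ≤ (k : ℤ)) :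
    2 * k - 1 ≤ disjointScrambleNumber G := by
  classical
  let M : Finset (Fin (4 * k)) := Finset.Icc ⟨k, by omega⟩ ⟨3 * k - 1, by omega⟩
  have hMcard : M.card = 2 * k := by
    simp only [M, Fin.card_Icc]
    omega
  refine le_disjointScrambleNumber (isDisjointScramble_singletonScramble (M := M)
    (Finset.card_pos.1 (by omega))) (le_min ?_ (le_eggCutNumber_singletonScramble ?_))
  · have := card_le_hittingNumber_singletonScramble M
    exact_mod_cast (show 2 * k - 1 ≤ hittingNumber (singletonScramble M) by omega)
  intro A x hx y hy hxA hyA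
  have key : ∀ a b : Fin (4 * k), ∀ i : ℕ, k ≤ i → i + 1 ≤ 3 * k - 1 → a ∈ A → b ∉ A →
      (a : ℕ) = i ∧ (b : ℕ) = i + 1 ∨ (b : ℕ) = i ∧ (a : ℕ) = i + 1 → 2 * k - 1 ≤ cutSize G A := by
    intro a b i hi hi' ha hb hab
    let I : Finset (Fin (4 * k)) := Finset.Icc ⟨i + 1 - k, by omega⟩ ⟨i + k, by omega⟩
    have hI : I.card = 2 * k := by
      simp only [I, Fin.card_Icc]
      omega
    have hcard : 2 * k - 2 ≤ ((I.erase a).erase b).card := by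
      have h1 := Finset.pred_card_le_card_erase (s := I) (a := a)
      have h2 := Finset.pred_card_le_card_erase (s := I.erase a) (a := b)
      omega
    have hadj : G.Adj a b := by
      rw [hG, ne_eq, Fin.ext_iff, abs_le]
      omega
    have := card_add_one_le_cutSize hadj ha hb ((I.erase a).erase b) (by
      intro w hw
      simp only [I, Finset.mem_erase, Finset.mem_Icc, Fin.le_def, ne_eq, Fin.ext_iff] at hw
      simp only [hG, ne_eq, Fin.ext_iff, abs_le]
      omega)
    omega
  simp only [M, Finset.mem_Icc, Fin.le_def] at hx hy
  let P : ℕ → Prop := fun j => ∃ h : j < 4 * k, (⟨j, h⟩ : Fin (4 * k)) ∈ A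
  have hP : ∀ v : Fin (4 * k), P v ↔ v ∈ A := fun v => ⟨fun h => h.2, fun h => ⟨v.2, h⟩⟩
  have hsplit : ∃ i, k ≤ i ∧ i + 1 ≤ 3 * k - 1 ∧ ¬(P i ↔ P (i + 1)) := by
    rcases le_total (x : ℕ) y with h | h
    · obtain ⟨i, h1, h2, h3⟩ := exists_consecutive_split (P := P) h (by simp [hP, hxA, hyA])
      exact ⟨i, by omega, by omega, h3⟩
    · obtain ⟨i, h1, h2, h3⟩ := exists_consecutive_split (P := P) h (by simp [hP, hxA, hyA])
      exact ⟨i, by omega, by omega, h3⟩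
  obtain ⟨i, hi, hi', hPi⟩ := hsplit
  have h1 := hP ⟨i, by omega⟩
  have h2 := hP ⟨i + 1, by omega⟩
  by_cases hiA : (⟨i, by omega⟩ : Fin (4 * k)) ∈ A
  · exact key ⟨i, by omega⟩ ⟨i + 1, by omega⟩ i hi hi' hiA (by tauto) (by simp)
  · exact key ⟨i + 1, by omega⟩ ⟨i, by omega⟩ i hi hi' (by tauto) hiA (by simp)

theorem pathGraph_isTree {n : ℕ} (hn : 0 < n) : (pathGraph n).IsTree := by
  obtain ⟨m, rfl⟩ := Nat.exists_eq_succ_of_ne_zero hn.ne'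
  have hconn := pathGraph_connected m
  refine isTree_iff_connected_and_card.2 ⟨hconn, le_antisymm ?_
    hconn.card_vert_le_card_edgeSet_add_one⟩
  let f : Fin m → (pathGraph (m + 1)).edgeSet := fun i =>
    ⟨s(i.castSucc, i.succ), by simp [pathGraph_adj]⟩
  have hf : Function.Surjective f := by
    rintro ⟨e, he⟩
    induction e using Sym2.ind with
    | _ u v =>
      rw [mem_edgeSet, pathGraph_adj] at he
      rcases he with h | h
      · refine ⟨⟨u, by omega⟩, Subtype.ext (Sym2.eq_iff.2 (Or.inl ?_))⟩
        simp [h]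
      · refine ⟨⟨v, by omega⟩, Subtype.ext (Sym2.eq_iff.2 (Or.inr ?_))⟩
        simp [h]
  have := Nat.card_le_card_of_surjective f hf
  simp only [Nat.card_eq_fintype_card, Fintype.card_fin, Nat.succ_eq_add_one] at this ⊢
  omega

/-- The path decomposition of a graph of bandwidth at most `k` into windows of `k + 1`
consecutive vertices. -/
def bandPathDecomp {n k : ℕ} (hn : 0 < n) {G : SimpleGraph (Fin n)}
    (hG : ∀ i j : Fin n, G.Adj i j → (j : ℕ) ≤ i + k) : TreeDecomp G where
  β := Fin n
  fintypeβ := inferInstance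
  T := pathGraph n
  isTree := pathGraph_isTree hn
  bag t := {j | (t : ℕ) ≤ j ∧ (j : ℕ) ≤ t + k}
  bag_cover v := ⟨v, by simp⟩
  bag_edge u v h := by
    have h1 := hG u v h
    have h2 := hG v u h.symm
    rcases le_total (u : ℕ) v with huv | huv
    · exact ⟨u, by simpa using ⟨huv, h1⟩⟩
    · exact ⟨v, by simpa using ⟨huv, h2⟩⟩
  bag_conn v := by
    have hv : v ∈ {t : Fin n | v ∈ ({j | (t : ℕ) ≤ j ∧ (j : ℕ) ≤ t + k} : Finset (Fin n))} := by
      simp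
    rw [connected_iff_exists_forall_reachable]
    refine ⟨⟨v, hv⟩, ?_⟩
    suffices H : ∀ d : ℕ, ∀ (t : Fin n) ht, (v : ℕ) = (t : ℕ) + d →
        ((pathGraph n).induce _).Reachable ⟨v, hv⟩ ⟨t, ht⟩ by
      rintro ⟨t, ht⟩
      have ht' := ht
      simp only [Finset.mem_filter, Finset.mem_univ, true_and, Set.mem_ofPred_eq] at ht'
      exact H (v - t) t ht (by omega)
    intro d
    induction d with
    | zero =>
      intro t ht h
      obtain rfl : v = t := Fin.ext h
      rfl
    | succ d ih =>
      intro t ht h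
      have ht' := ht
      simp only [Finset.mem_filter, Finset.mem_univ, true_and, Set.mem_ofPred_eq] at ht'
      have hs : (⟨t + 1, by omega⟩ : Fin n) ∈
          {t : Fin n | v ∈ ({j | (t : ℕ) ≤ j ∧ (j : ℕ) ≤ t + k} : Finset (Fin n))} := by
        simp only [Finset.mem_filter, Finset.mem_univ, true_and, Set.mem_ofPred_eq]
        omega
      refine (ih _ hs (by dsimp only; omega)).trans (Adj.reachable ?_)
      simp [pathGraph_adj]

lemma bandPathDecomp_width_le {n k : ℕ} (hn : 0 < n) {G : SimpleGraph (Fin n)}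
    (hG : ∀ i j : Fin n, G.Adj i j → (j : ℕ) ≤ i + k) : (bandPathDecomp hn hG).width ≤ k := by
  refine Nat.sub_le_of_le_add (csSup_le' ?_)
  rintro _ ⟨t, rfl⟩
  change Fin n at t
  calc _ = (Finset.image Fin.val ((bandPathDecomp hn hG).bag t)).card :=
        (Finset.card_image_of_injective _ Fin.val_injective).symm
    _ ≤ (Finset.Icc (t : ℕ) (t + k)).card := by
        refine Finset.card_le_card fun x hx => ?_
        obtain ⟨y, hy, rfl⟩ := Finset.mem_image.1 hx
        simpa [bandPathDecomp] using hy
    _ = k + 1 := by simp; omega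

/-- In a tree rooted at `r`, the path from an element of a connected set to the root passes
through every closest element `m` of the set to the root, and stays in the set until then. -/
lemma exists_isPath_append {β : Type*} {T : SimpleGraph β} (r : β)
    {S : Set β} (hS : (T.induce S).Connected) {m s : β} (hm : m ∈ S) (hs : s ∈ S)
    (hmin : ∀ x ∈ S, T.dist m r ≤ T.dist x r) (hT : T.Connected) :
    ∃ (p : T.Walk s m) (q : T.Walk m r), (p.append q).IsPath ∧ (∀ x ∈ p.support, x ∈ S) ∧
      ∀ x ∈ q.support, x ≠ m → T.dist x r < T.dist m r := by
  classical
  obtain ⟨p₀, hp₀⟩ := (hS.preconnected ⟨s, hs⟩ ⟨m, hm⟩).exists_isPath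
  let p : T.Walk s m := p₀.map (Embedding.induce S).toHom
  have hp : p.IsPath := hp₀.map Subtype.val_injective
  have hpS : ∀ x ∈ p.support, x ∈ S := by
    intro x hx
    obtain ⟨y, -, rfl⟩ := List.mem_map.1 ((Walk.support_map _ p₀) ▸ hx)
    exact y.2
  obtain ⟨q, hq, hqlen⟩ := hT.exists_path_of_dist m r
  have hqd : ∀ x ∈ q.support, x ≠ m → T.dist x r < T.dist m r := by
    intro x hx hxm
    have h1 := congrArg Walk.length (q.take_spec hx)
    rw [Walk.length_append] at h1
    have h2 := dist_le (q.dropUntil x hx)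
    have h3 : (q.takeUntil x hx).length ≠ 0 := fun h => hxm (Walk.eq_of_length_eq_zero h).symm
    omega
  refine ⟨p, q, ?_, hpS, hqd⟩
  rw [Walk.isPath_def, Walk.support_append, List.nodup_append]
  have hqn := hq.support_nodup
  rw [← Walk.cons_tail_support, List.nodup_cons] at hqn
  refine ⟨hp.support_nodup, hqn.2, ?_⟩
  rintro x hx y hy rfl
  have hxm : x ≠ m := by rintro rfl; exact hqn.1 hy
  exact absurd (hqd x (List.mem_of_mem_tail hy) hxm) (not_lt.2 (hmin x (hpS x hx)))

/-- Some bag of a tree decomposition contains a vertex together with all its neighbours. -/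
theorem exists_bag_closed_neighbors [Finite V] [Nonempty V] (D : TreeDecomp G) :
    ∃ v t, v ∈ D.bag t ∧ ∀ w, G.Adj v w → w ∈ D.bag t := by
  obtain ⟨r⟩ := D.isTree.connected.nonempty
  have htop : ∀ v, ∃ m, v ∈ D.bag m ∧ ∀ x, v ∈ D.bag x → D.T.dist m r ≤ D.T.dist x r := by
    intro v
    have hne : {t | v ∈ D.bag t}.Nonempty := D.bag_cover v
    exact ⟨Function.argminOn (D.T.dist · r) _ hne, Function.argminOn_mem (D.T.dist · r) _ hne,
      fun x hx => Function.argminOn_le (D.T.dist · r) {t | v ∈ D.bag t} hx⟩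
  choose top htop hmin using htop
  obtain ⟨v, hv⟩ := Finite.exists_max fun v => D.T.dist (top v) r
  refine ⟨v, top v, htop v, fun w hvw => ?_⟩
  obtain ⟨s, hsv, hsw⟩ := D.bag_edge v w hvw
  obtain ⟨p, q, hpq, -, -⟩ := exists_isPath_append r (D.bag_conn v) (htop v) hsv (hmin v)
    D.isTree.connected
  obtain ⟨p', q', hpq', hp', hq'⟩ := exists_isPath_append r (D.bag_conn w) (htop w) hsw (hmin w)
    D.isTree.connected
  have heq : p.append q = p'.append q' := (D.isTree.existsUnique_path s r).unique hpq hpq'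
  have hmem : top v ∈ (p'.append q').support := by
    rw [← heq, Walk.mem_support_append_iff]
    exact Or.inl p.end_mem_support
  rcases (Walk.mem_support_append_iff _ _).1 hmem with h | h
  · exact hp' _ h
  · by_cases hne : top v = top w
    · rw [hne]
      exact htop w
    · exact absurd (hq' _ h hne) (not_lt.2 (hv w))

/-- The minimum degree is a lower bound for the width of a tree decomposition. -/
theorem le_width_of_le_degree [Fintype V] [Nonempty V] {k : ℕ}
    (hdeg : ∀ v, ∃ N : Finset V, N.card = k ∧ ∀ w ∈ N, G.Adj v w) (D : TreeDecomp G) :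
    k ≤ D.width := by
  classical
  obtain ⟨v, t, hv, ht⟩ := exists_bag_closed_neighbors D
  obtain ⟨N, hN, hadj⟩ := hdeg v
  have hcard : k + 1 ≤ (D.bag t).card := by
    rw [← hN, ← Finset.card_insert_of_notMem fun h => (hadj v h).ne rfl]
    exact Finset.card_le_card (Finset.insert_subset hv fun w hw => ht w (hadj w hw))
  refine Nat.le_sub_of_add_le (hcard.trans (le_csSup ⟨Fintype.card V, ?_⟩ ⟨t, rfl⟩))
  rintro _ ⟨t, rfl⟩
  exact Finset.card_le_univ _

theorem treewidth_eq_of_band {k : ℕ} (hk : 1 ≤ k) {G : SimpleGraph (Fin (4 * k))}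
    (hG : ∀ i j : Fin (4 * k), G.Adj i j ↔ i ≠ j ∧ |(i : ℤ) - (j : ℤ)| ≤ (k : ℤ)) :
    treewidth G = k := by
  have hband : ∀ i j : Fin (4 * k), G.Adj i j → (j : ℕ) ≤ i + k := by
    intro i j h
    rw [hG, abs_le] at h
    omega
  have hpos : 0 < 4 * k := by omega
  have : Nonempty (Fin (4 * k)) := ⟨⟨0, hpos⟩⟩
  let D := bandPathDecomp hpos hband
  have hne : {n | ∃ D : TreeDecomp G, D.width = n}.Nonempty := ⟨D.width, D, rfl⟩
  have hle : treewidth G ≤ D.width := Nat.sInf_le ⟨D, rfl⟩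
  refine le_antisymm (hle.trans (bandPathDecomp_width_le hpos hband)) (le_csInf hne ?_)
  rintro _ ⟨D', rfl⟩
  refine le_width_of_le_degree (fun v => ?_) D'
  by_cases hv : (v : ℕ) < 2 * k
  · refine ⟨Finset.Icc ⟨v + 1, by omega⟩ ⟨v + k, by omega⟩, by simp only [Fin.card_Icc]; omega, ?_⟩
    intro w hw
    simp only [Finset.mem_Icc, Fin.le_def] at hw
    rw [hG, ne_eq, Fin.ext_iff, abs_le]
    omega
  · refine ⟨Finset.Icc ⟨v - k, by omega⟩ ⟨v - 1, by omega⟩, by simp only [Fin.card_Icc]; omega, ?_⟩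
    intro w hw
    simp only [Finset.mem_Icc, Fin.le_def] at hw
    rw [hG, ne_eq, Fin.ext_iff, abs_le]
    omega

end SimpleGraph

/-- For `k ≥ 1`, let `G` be the simple graph on `4k` vertices
`{0, 1, …, 4k − 1}` in which distinct vertices `i` and `j` are adjacent iff
`|i − j| ≤ k`. Then `dsn(G) ≥ 2k − 1` and `tw(G) = k`; in particular
`dsn(G) − tw(G) ≥ k − 1`. -/
theorem dsn_sub_tw_of_band_graph (k : ℕ) (hk : 1 ≤ k) (G : SimpleGraph (Fin (4 * k)))
    (hG : ∀ i j : Fin (4 * k), G.Adj i j ↔ i ≠ j ∧ |(i : ℤ) - (j : ℤ)| ≤ (k : ℤ)) :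
    2 * k - 1 ≤ disjointScrambleNumber G ∧ treewidth G = k ∧
      k - 1 ≤ disjointScrambleNumber G - treewidth G := by
  have hd := SimpleGraph.le_disjointScrambleNumber_of_band hk hG
  have ht := SimpleGraph.treewidth_eq_of_band hk hG
  exact ⟨hd, ht, by omega⟩
end
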